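/- Let d ≥ 2, let M be the uncentered maximal operator on ℝ^d associated to balls of the ℓ₁ norm (cross-polytopes), and let ω be a modulus of continuity (distances measured in the ℓ₁ norm). Then ‖M‖_{Op(ω)} = sup_{t>0} inf_{1/2 ≤ R ≤ 1} (d(d−1)/(2ω(t))) · ∫_{−1}^{1} ∫_{0}^{1−|u₁|} ω( t·(|1 − R + R u₁| + Rρ) ) ρ^{d−2} dρ du₁. Moreover, if the same modulus ω is chosen in all dimensions, then lim_{d→∞} ‖M‖_{Op(ω)} = 1. -/

import Mathlib

open MeasureTheory Set Filter Topology

/-- The closed ball of the norm-like function `N`, with center `c` and radius `R`. -/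
def nball {d : ℕ} (N : (Fin d → ℝ) → ℝ) (c : Fin d → ℝ) (R : ℝ) : Set (Fin d → ℝ) :=
  {y | N (y - c) ≤ R}

/-- The uncentered Hardy–Littlewood maximal function associated to the norm `N`,
with respect to `d`-dimensional Lebesgue measure. -/
noncomputable def maxFn {d : ℕ} (N : (Fin d → ℝ) → ℝ) (f : (Fin d → ℝ) → ℝ)
    (x : Fin d → ℝ) : ℝ :=
  sSup {a : ℝ | ∃ c : Fin d → ℝ, ∃ R : ℝ, 0 < R ∧ x ∈ nball N c R ∧
    a = ⨍ y in nball N c R, |f y|}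

/-- The modulus of continuity of `g`, with distances measured using `N`. -/
noncomputable def modCont {d : ℕ} (N : (Fin d → ℝ) → ℝ) (g : (Fin d → ℝ) → ℝ) (δ : ℝ) : ℝ :=
  sSup {a : ℝ | ∃ x y : Fin d → ℝ, N (x - y) ≤ δ ∧ a = |g x - g y|}

/-- `N` is a norm on `ℝ^d`. -/
structure IsNorm {d : ℕ} (N : (Fin d → ℝ) → ℝ) : Prop where
  eq_zero_iff : ∀ x, N x = 0 ↔ x = 0
  add_le : ∀ x y, N (x + y) ≤ N x + N y
  smul : ∀ (a : ℝ) (x), N (a • x) = |a| * N x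

/-- `ω` is a modulus of continuity: continuous, nondecreasing, subadditive on `[0,∞)`,
vanishing at `0`, nonnegative, and not identically zero. -/
structure IsModulus (ω : ℝ → ℝ) : Prop where
  nonneg : ∀ t, 0 ≤ t → 0 ≤ ω t
  map_zero : ω 0 = 0
  mono : MonotoneOn ω (Ici 0)
  subadd : ∀ a b, 0 ≤ a → 0 ≤ b → ω (a + b) ≤ ω a + ω b
  cont : ContinuousOn ω (Ici 0)
  nontrivial : ∃ t, 0 < t ∧ ω t ≠ 0

/-- The `Lip(ω)` seminorm of `f`: `sup_{t>0} ω(f,t)/ω(t)`. -/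
noncomputable def lipNorm {d : ℕ} (N : (Fin d → ℝ) → ℝ) (ω : ℝ → ℝ)
    (f : (Fin d → ℝ) → ℝ) : ℝ :=
  sSup {a : ℝ | ∃ t : ℝ, 0 < t ∧ a = modCont N f t / ω t}

/-- The operator norm of the uncentered maximal operator on `Lip(ω)`. -/
noncomputable def opNorm (d : ℕ) (N : (Fin d → ℝ) → ℝ) (ω : ℝ → ℝ) : ℝ :=
  sSup {a : ℝ | ∃ f : (Fin d → ℝ) → ℝ, lipNorm N ω f = 1 ∧ a = lipNorm N ω (maxFn N f)}

/-- The Hölder `α` seminorm of `f`, distances measured with `N`. -/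
noncomputable def holderNorm {d : ℕ} (N : (Fin d → ℝ) → ℝ) (α : ℝ)
    (f : (Fin d → ℝ) → ℝ) : ℝ :=
  sSup {a : ℝ | ∃ x y : Fin d → ℝ, x ≠ y ∧ a = |f x - f y| / N (x - y) ^ α}

/-- The operator norm of the uncentered maximal operator on the Hölder class `Lip_α`. -/
noncomputable def opNormHolder (d : ℕ) (N : (Fin d → ℝ) → ℝ) (α : ℝ) : ℝ :=
  sSup {a : ℝ | ∃ f : (Fin d → ℝ) → ℝ, holderNorm N α f = 1 ∧
    a = holderNorm N α (maxFn N f)}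

/-- The operator norm, on `Lip(ω)` for `ℓ₁` distances, of the uncentered maximal operator
associated to `ℓ₁` balls (cross-polytopes) in dimension `d`. -/
noncomputable def op1 (ω : ℝ → ℝ) (d : ℕ) : ℝ :=
  opNorm d (fun x => ∑ i, |x i|) ω

/-- The `ℓ₁` norm on `ℝ^d`. -/
noncomputable def l1 {d : ℕ} (x : Fin d → ℝ) : ℝ := ∑ i, |x i|

section L1

variable {d : ℕ}

lemma l1_nonneg (x : Fin d → ℝ) : 0 ≤ l1 x := Finset.sum_nonneg fun _ _ => abs_nonneg _

lemma l1_add_le (x y : Fin d → ℝ) : l1 (x + y) ≤ l1 x + l1 y := by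
  simp only [l1, ← Finset.sum_add_distrib]
  exact Finset.sum_le_sum fun i _ => abs_add_le _ _

lemma l1_smul (a : ℝ) (x : Fin d → ℝ) : l1 (a • x) = |a| * l1 x := by
  simp [l1, abs_mul, Finset.mul_sum]

lemma l1_neg (x : Fin d → ℝ) : l1 (-x) = l1 x := by simp [l1]

lemma l1_zero : l1 (0 : Fin d → ℝ) = 0 := by simp [l1]

lemma l1_sub_comm (x y : Fin d → ℝ) : l1 (x - y) = l1 (y - x) := by
  rw [← l1_neg, neg_sub]

lemma abs_apply_le_l1 (x : Fin d → ℝ) (i : Fin d) : |x i| ≤ l1 x :=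
  Finset.single_le_sum (f := fun i => |x i|) (fun _ _ => abs_nonneg _) (Finset.mem_univ i)

lemma abs_l1_sub_l1_le (x y : Fin d → ℝ) : |l1 x - l1 y| ≤ l1 (x - y) := by
  have h1 := l1_add_le (x - y) y
  have h2 := l1_add_le (y - x) x
  rw [sub_add_cancel] at h1 h2
  rw [l1_sub_comm y x] at h2
  rw [abs_le]
  constructor <;> linarith

lemma l1_eq_zero_iff (x : Fin d → ℝ) : l1 x = 0 ↔ x = 0 := by
  constructor
  · intro h
    funext i
    have := abs_apply_le_l1 x i
    rw [h] at this
    simpa using le_antisymm this (abs_nonneg _)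
  · rintro rfl
    exact l1_zero

lemma l1_single (i : Fin d) (a : ℝ) : l1 (Pi.single i a : Fin d → ℝ) = |a| := by
  rw [l1, Finset.sum_eq_single i]
  · simp
  · intro j _ hj
    simp [Pi.single_eq_of_ne hj]
  · simp

@[fun_prop]
lemma continuous_l1 : Continuous (l1 : (Fin d → ℝ) → ℝ) := by
  unfold l1
  fun_prop

lemma isCompact_nball (c : Fin d → ℝ) (r : ℝ) : IsCompact (nball l1 c r) := by
  refine Metric.isCompact_of_isClosed_isBounded ?_ ?_
  · exact isClosed_le (by fun_prop) continuous_const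
  · refine (Metric.isBounded_closedBall (x := c) (r := |r|)).subset fun y hy => ?_
    rw [Metric.mem_closedBall, dist_pi_le_iff (abs_nonneg _)]
    intro i
    exact ((abs_apply_le_l1 (y - c) i).trans hy).trans (le_abs_self r)

lemma measurableSet_nball (c : Fin d → ℝ) (r : ℝ) : MeasurableSet (nball l1 c r) :=
  (isCompact_nball c r).isClosed.measurableSet

lemma integrableOn_nball {g : (Fin d → ℝ) → ℝ} (hg : Continuous g) (c : Fin d → ℝ) (r : ℝ) :
    IntegrableOn g (nball l1 c r) :=
  hg.continuousOn.integrableOn_compact (isCompact_nball c r)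

/-- Two-point comparison: an involution `σ` exchanging `A` and `A'` and increasing `G` on
`A \ A'` increases the integral. -/
lemma setIntegral_le_of_involutive {G : (Fin d → ℝ) → ℝ} {σ : (Fin d → ℝ) → (Fin d → ℝ)}
    (hσ : MeasurePreserving σ) (hinv : Function.Involutive σ) {A A' : Set (Fin d → ℝ)}
    (hA : MeasurableSet A) (hA' : MeasurableSet A') (hAA' : ∀ z, σ z ∈ A' ↔ z ∈ A)
    (hGA : IntegrableOn G A) (hGA' : IntegrableOn G A')
    (hG : ∀ z ∈ A, z ∉ A' → G z ≤ G (σ z)) :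
    ∫ z in A, G z ≤ ∫ z in A', G z := by
  have hemb : MeasurableEmbedding σ :=
    (MeasurableEquiv.mk (hinv.toPerm σ) hσ.measurable hσ.measurable).measurableEmbedding
  have hpre : σ ⁻¹' (A' \ A) = A \ A' := by
    ext z
    have h := hAA' (σ z)
    rw [hinv z] at h
    simp only [mem_preimage, Set.mem_sdiff, hAA', h]
  have h1 : ∫ z in A' \ A, G z = ∫ z in A \ A', G (σ z) := by
    rw [← hpre]
    exact (hσ.setIntegral_preimage_emb hemb G (A' \ A)).symm
  have h2 : IntegrableOn (G ∘ σ) (A \ A') := by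
    rw [← hpre]
    exact (hσ.integrableOn_comp_preimage hemb).2 (hGA'.mono_set sdiff_subset)
  rw [← integral_inter_add_sdiff hA' hGA, ← integral_inter_add_sdiff hA hGA', inter_comm A' A, h1]
  refine add_le_add le_rfl ?_
  exact setIntegral_mono_on (hGA.mono_set sdiff_subset) h2 (hA.diff hA') fun z hz => hG z hz.1 hz.2

/-- Reflection in the coordinate `i`. -/
def reflectCoord (i : Fin d) (m : ℝ) (z : Fin d → ℝ) : Fin d → ℝ :=
  Function.update z i (m - z i)

lemma measurePreserving_reflectCoord (i : Fin d) (m : ℝ) :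
    MeasurePreserving (reflectCoord i m) := by
  have : reflectCoord i m =
      fun (z : Fin d → ℝ) j => (if j = i then fun x : ℝ => m - x else id) (z j) := by
    funext z j
    by_cases h : j = i
    · subst h; simp [reflectCoord]
    · simp [reflectCoord, h]
  rw [this]
  refine volume_preserving_pi fun j => ?_
  by_cases h : j = i
  · simpa [h] using Measure.measurePreserving_sub_left (volume : Measure ℝ) m
  · simpa [h] using MeasurePreserving.id _

lemma involutive_reflectCoord (i : Fin d) (m : ℝ) : Function.Involutive (reflectCoord i m) := by
  intro z
  simp [reflectCoord]

lemma l1_eq_add_sum_erase (i : Fin d) (x : Fin d → ℝ) :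
    l1 x = |x i| + ∑ j ∈ Finset.univ.erase i, |x j| :=
  (Finset.add_sum_erase _ _ (Finset.mem_univ i)).symm

lemma l1_sub_update (i : Fin d) (x y : Fin d → ℝ) (a b : ℝ) :
    l1 (Function.update x i a - Function.update y i b) =
      |a - b| + ∑ j ∈ Finset.univ.erase i, |x j - y j| := by
  rw [l1_eq_add_sum_erase i]
  congr 1
  · simp
  · refine Finset.sum_congr rfl fun j hj => ?_
    simp [Finset.ne_of_mem_erase hj]

variable {g : ℝ → ℝ}

lemma setIntegral_nball_update_le (hg : Continuous g) (hmono : MonotoneOn g (Ici 0))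
    (c : Fin d → ℝ) (i : Fin d) {a : ℝ} (ha : |a| ≤ |c i|) (r : ℝ) :
    ∫ y in nball l1 (Function.update c i a) r, g (l1 y) ≤ ∫ y in nball l1 c r, g (l1 y) := by
  have hG : Continuous fun y : Fin d → ℝ => g (l1 y) := hg.comp continuous_l1
  have key : ∀ z : Fin d → ℝ, l1 (reflectCoord i (c i + a) z - c) =
      l1 (z - Function.update c i a) := by
    intro z
    have h1 := l1_sub_update i z c (c i + a - z i) (c i)
    have h2 := l1_sub_update i z c (z i) a
    rw [Function.update_eq_self] at h1 h2
    rw [reflectCoord, h1, h2, abs_sub_comm (z i)]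
    congr 2
    ring
  refine setIntegral_le_of_involutive (measurePreserving_reflectCoord i (c i + a))
    (involutive_reflectCoord _ _) (measurableSet_nball _ _) (measurableSet_nball _ _)
    (fun z => by simp only [nball, mem_ofPred_eq, key]) (integrableOn_nball hG _ _)
    (integrableOn_nball hG _ _) fun z hz hz' => ?_
  refine hmono (l1_nonneg _) (l1_nonneg _) ?_
  have hlt : l1 (z - Function.update c i a) < l1 (z - c) := lt_of_le_of_lt hz (not_le.1 hz')
  have h1 := l1_sub_update i z c (z i) (c i)
  have h2 := l1_sub_update i z c (z i) a
  rw [Function.update_eq_self] at h1 h2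
  rw [Function.update_eq_self] at h1
  rw [h1, h2] at hlt
  have h3 := l1_sub_update i z 0 (z i) 0
  have h4 := l1_sub_update i z 0 (c i + a - z i) 0
  have h0 : Function.update (0 : Fin d → ℝ) i 0 = 0 := by simp
  rw [h0, sub_zero] at h3 h4
  rw [Function.update_eq_self] at h3
  rw [reflectCoord, h3, h4]
  gcongr 1
  have hlt' : |z i - a| < |z i - c i| := by linarith
  rw [sub_zero, sub_zero]
  rcases abs_cases (z i - a) with h5 | h5 <;> rcases abs_cases (z i - c i) with h6 | h6 <;>
  rcases abs_cases a with h7 | h7 <;> rcases abs_cases (c i) with h8 | h8 <;>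
  rcases abs_cases (z i) with h9 | h9 <;> rcases abs_cases (c i + a - z i) with h10 | h10 <;>
  linarith

lemma setIntegral_nball_mono (hg : Continuous g) (hmono : MonotoneOn g (Ici 0))
    {c c' : Fin d → ℝ} (h : ∀ i, |c' i| ≤ |c i|) (r : ℝ) :
    ∫ y in nball l1 c' r, g (l1 y) ≤ ∫ y in nball l1 c r, g (l1 y) := by
  have key : ∀ S : Finset (Fin d), ∫ y in nball l1 (S.piecewise c' c) r, g (l1 y) ≤
      ∫ y in nball l1 c r, g (l1 y) := by
    intro S
    induction S using Finset.induction_on with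
    | empty => simp
    | insert i S hi ih =>
      rw [Finset.piecewise_insert]
      refine (setIntegral_nball_update_le hg hmono _ i ?_ r).trans ih
      simpa [hi] using h i
  simpa using key Finset.univ

/-- Swap the coordinates `i` and `j`, then translate by `a (e_i - e_j)`. -/
def swapShift (i j : Fin d) (a : ℝ) (z : Fin d → ℝ) : Fin d → ℝ :=
  fun k => z (Equiv.swap i j k) + (Pi.single i a - Pi.single j a : Fin d → ℝ) k

lemma measurePreserving_swapShift (i j : Fin d) (a : ℝ) :
    MeasurePreserving (swapShift i j a) := by
  have h1 := volume_measurePreserving_piCongrLeft (fun _ : Fin d => ℝ) (Equiv.swap i j)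
  have h2 := measurePreserving_add_right (volume : Measure (Fin d → ℝ))
    (Pi.single i a - Pi.single j a)
  convert! h2.comp h1 using 1
  funext z k
  simp only [swapShift, Function.comp_apply, Pi.add_apply, MeasurableEquiv.coe_piCongrLeft]
  congr 1
  conv_rhs => rw [← Equiv.swap_apply_self i j k]
  rw [Equiv.piCongrLeft_apply_apply]

lemma involutive_swapShift {i j : Fin d} (hij : i ≠ j) (a : ℝ) :
    Function.Involutive (swapShift i j a) := by
  intro z
  funext k
  simp only [swapShift, Equiv.swap_apply_self, Pi.sub_apply]
  by_cases hi : k = i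
  · subst hi
    simp [hij, hij.symm]
  · by_cases hj : k = j
    · subst hj
      simp [hij, hij.symm]
    · simp [hi, hj, Equiv.swap_apply_of_ne_of_ne]

lemma l1_eq_add_add_sum {i j : Fin d} (hij : i ≠ j) (x : Fin d → ℝ) :
    l1 x = |x i| + |x j| + ∑ k ∈ (Finset.univ.erase i).erase j, |x k| := by
  rw [l1_eq_add_sum_erase i, add_assoc,
    Finset.add_sum_erase _ (fun k => |x k|) (Finset.mem_erase.2 ⟨hij.symm, Finset.mem_univ j⟩)]

/-- Transferring mass from the coordinate `j` to the coordinate `i`. -/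
lemma setIntegral_nball_transfer_le (hg : Continuous g) (hmono : MonotoneOn g (Ici 0))
    (c : Fin d → ℝ) {i j : Fin d} (hij : i ≠ j) (hi : 0 ≤ c i) (hj : 0 ≤ c j) (r : ℝ) :
    ∫ y in nball l1 c r, g (l1 y) ≤
      ∫ y in nball l1 (Function.update (Function.update c i (c i + c j)) j 0) r, g (l1 y) := by
  have hG : Continuous fun y : Fin d → ℝ => g (l1 y) := hg.comp continuous_l1
  set c' := Function.update (Function.update c i (c i + c j)) j 0 with hc'
  have ci : c' i = c i + c j := by simp [hc', hij]
  have cj : c' j = 0 := by simp [hc']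
  have ck : ∀ k ∈ (Finset.univ.erase i).erase j, c' k = c k := by
    intro k hk
    simp only [Finset.mem_erase, Finset.mem_univ, and_true] at hk
    simp [hc', hk.1, hk.2]
  have si : ∀ z, swapShift i j (c i) z i = z j + c i := fun z => by simp [swapShift, hij]
  have sj : ∀ z, swapShift i j (c i) z j = z i - c i := fun z => by
    simp [swapShift, hij.symm, sub_eq_add_neg]
  have sk : ∀ z, ∀ k ∈ (Finset.univ.erase i).erase j, swapShift i j (c i) z k = z k := by
    intro z k hk
    simp only [Finset.mem_erase, Finset.mem_univ, and_true] at hk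
    simp [swapShift, hk.1, hk.2, Equiv.swap_apply_of_ne_of_ne]
  have key : ∀ z : Fin d → ℝ, l1 (swapShift i j (c i) z - c') = l1 (z - c) := by
    intro z
    rw [l1_eq_add_add_sum hij, l1_eq_add_add_sum hij (z - c)]
    congr 1
    · simp only [Pi.sub_apply, si, sj, ci, cj]
      rw [add_comm]
      congr 2 <;> ring
    · refine Finset.sum_congr rfl fun k hk => ?_
      simp only [Pi.sub_apply, sk z k hk, ck k hk]
  refine setIntegral_le_of_involutive (measurePreserving_swapShift i j (c i))
    (involutive_swapShift hij _) (measurableSet_nball _ _) (measurableSet_nball _ _)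
    (fun z => by simp only [nball, mem_ofPred_eq, key]) (integrableOn_nball hG _ _)
    (integrableOn_nball hG _ _) fun z hz hz' => ?_
  refine hmono (l1_nonneg _) (l1_nonneg _) ?_
  have hlt : l1 (z - c) < l1 (z - c') := lt_of_le_of_lt hz (not_le.1 hz')
  rw [l1_eq_add_add_sum hij, l1_eq_add_add_sum hij (z - c')] at hlt
  rw [Finset.sum_congr rfl (g := fun k => |(z - c) k|)
    (s₂ := (Finset.univ.erase i).erase j) (f := fun k => |(z - c') k|)
    (fun k hk => by simp only [Pi.sub_apply, ck k hk])] at hlt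
  simp only [Pi.sub_apply, ci, cj, sub_zero] at hlt
  rw [l1_eq_add_add_sum hij, l1_eq_add_add_sum hij (swapShift i j (c i) z), si, sj]
  rw [Finset.sum_congr rfl (f := fun k => |swapShift i j (c i) z k|) (g := fun k => |z k|)
    (s₂ := (Finset.univ.erase i).erase j) (fun k hk => by simp only [sk z k hk])]
  gcongr 1
  have hlt' := lt_of_add_lt_add_right hlt
  rcases abs_cases (z i - c i) with h1 | h1 <;> rcases abs_cases (z j - c j) with h2 | h2 <;>
  rcases abs_cases (z i - (c i + c j)) with h3 | h3 <;> rcases abs_cases (z i) with h4 | h4 <;>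
  rcases abs_cases (z j) with h5 | h5 <;> rcases abs_cases (z j + c i) with h6 | h6 <;> linarith

/-- Among the centers of given `ℓ₁` norm, the vertices of the cross-polytope maximize the integral
of a radially nondecreasing function. -/
lemma setIntegral_nball_le_single (hg : Continuous g) (hmono : MonotoneOn g (Ici 0))
    (c : Fin d → ℝ) (i : Fin d) (r : ℝ) :
    ∫ y in nball l1 c r, g (l1 y) ≤ ∫ y in nball l1 (Pi.single i (l1 c)) r, g (l1 y) := by
  have key : ∀ S : Finset (Fin d), i ∉ S → ∫ y in nball l1 c r, g (l1 y) ≤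
      ∫ y in nball l1 (fun k => if k = i then |c i| + ∑ k ∈ S, |c k| else
        if k ∈ S then 0 else |c k|) r, g (l1 y) := by
    intro S
    induction S using Finset.induction_on with
    | empty =>
      intro _
      refine setIntegral_nball_mono hg hmono (fun k => ?_) r
      by_cases h : k = i <;> simp [h]
    | insert j S hj ih =>
      intro hi
      rw [Finset.mem_insert, not_or] at hi
      refine (ih hi.2).trans ((setIntegral_nball_transfer_le hg hmono _ hi.1 ?_ ?_ r).trans
        (le_of_eq ?_))
      · simp only [if_true]
        positivity
      · simp [hj, Ne.symm hi.1]
      · congr 3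
        funext k
        by_cases hk : k = j
        · subst hk
          simp [Ne.symm hi.1]
        · by_cases hk' : k = i
          · subst hk'
            simp [hk, Ne.symm hk, hj, Finset.sum_insert hj]
            ring
          · simp [hk, hk']
  refine (key (Finset.univ.erase i) (Finset.notMem_erase _ _)).trans (le_of_eq ?_)
  congr 3
  funext k
  by_cases hk : k = i
  · subst hk
    simp [l1_eq_add_sum_erase k c]
  · simp [hk]

end L1

section Formula

lemma volume_l1_ball (d : ℕ) :
    (volume : Measure (Fin d → ℝ)) {x | l1 x < 1} = ENNReal.ofReal (2 ^ d / d.factorial) := by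
  have h := volume_sum_rpow_lt_one (Fin d) (p := 1) le_rfl
  simp only [Real.rpow_one, div_one, Fintype.card_fin] at h
  rw [Real.Gamma_nat_eq_factorial, show (1 : ℝ) + 1 = ((1 : ℕ) : ℝ) + 1 by norm_num,
    Real.Gamma_nat_eq_factorial, Nat.factorial_one, Nat.cast_one, mul_one] at h
  exact h

lemma volume_nball_unit (d : ℕ) :
    volume.real (nball l1 (0 : Fin (d + 1) → ℝ) 1) = 2 ^ (d + 1) / (d + 1).factorial := by
  have h := volume_sum_rpow_le (Fin (d + 1)) (p := 1) le_rfl 1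
  simp only [Real.rpow_one, div_one, Fintype.card_fin, ENNReal.ofReal_one, one_pow, one_mul] at h
  rw [Real.Gamma_nat_eq_factorial, show (1 : ℝ) + 1 = ((1 : ℕ) : ℝ) + 1 by norm_num,
    Real.Gamma_nat_eq_factorial, Nat.factorial_one, Nat.cast_one, mul_one] at h
  simp only [nball, sub_zero, l1, Measure.real]
  rw [h, ENNReal.toReal_ofReal (by positivity)]

/-- Integration of an `ℓ₁`-radial function. -/
lemma integral_comp_l1 (n : ℕ) (φ : ℝ → ℝ) :
    ∫ x : Fin (n + 1) → ℝ, φ (l1 x) =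
      2 ^ (n + 1) / n.factorial * ∫ y in Ioi (0 : ℝ), y ^ n * φ y := by
  let L : (Fin (n + 1) → ℝ) ≃L[ℝ] PiLp 1 (fun _ : Fin (n + 1) => ℝ) :=
    (PiLp.continuousLinearEquiv 1 ℝ (fun _ : Fin (n + 1) => ℝ)).symm
  let ν : Measure (PiLp 1 (fun _ : Fin (n + 1) => ℝ)) := volume.map L
  have hnorm : ∀ x, ‖L x‖ = l1 x := fun x => by
    simp [L, PiLp.norm_eq_of_L1, l1]
  have hL : MeasurableEmbedding L := L.toHomeomorph.measurableEmbedding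
  have hν : ν.IsAddHaarMeasure := L.isAddHaarMeasure_map volume
  have h1 : ∫ y, φ ‖y‖ ∂ν = ∫ x : Fin (n + 1) → ℝ, φ (l1 x) := by
    rw [hL.integral_map]
    simp only [hnorm]
  have h2 : ν.real (Metric.ball 0 1) = 2 ^ (n + 1) / (n + 1).factorial := by
    rw [Measure.real, hL.map_apply]
    have : L ⁻¹' Metric.ball 0 1 = {x | l1 x < 1} := by
      ext x
      simp [hnorm]
    rw [this, volume_l1_ball, ENNReal.toReal_ofReal (by positivity)]
  have h3 : Module.finrank ℝ (PiLp 1 (fun _ : Fin (n + 1) => ℝ)) = n + 1 := by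
    rw [← L.toLinearEquiv.finrank_eq]
    simp
  rw [← h1, integral_fun_norm_addHaar, h2, h3]
  simp only [nsmul_eq_mul, smul_eq_mul, Nat.add_sub_cancel]
  rw [← mul_assoc]
  congr 1
  rw [Nat.factorial_succ]
  push_cast
  field_simp

lemma setIntegral_nball_unit (n : ℕ) {h : ℝ → ℝ → ℝ} (hh : Continuous (Function.uncurry h)) :
    ∫ w in nball l1 (0 : Fin (n + 2) → ℝ) 1, h (w 0) (l1 fun i : Fin (n + 1) => w i.succ) =
      2 ^ (n + 1) / n.factorial *
        ∫ u in Icc (-1 : ℝ) 1, ∫ ρ in Icc (0 : ℝ) (1 - |u|), h u ρ * ρ ^ n := by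
  have hcont : Continuous fun w : Fin (n + 2) → ℝ =>
      h (w 0) (l1 fun i : Fin (n + 1) => w i.succ) :=
    hh.comp (f := fun w : Fin (n + 2) → ℝ => (w 0, l1 fun i : Fin (n + 1) => w i.succ))
      ((continuous_apply 0).prodMk (continuous_l1.comp (by fun_prop)))
  set F : (Fin (n + 2) → ℝ) → ℝ := (nball l1 0 1).indicator
    fun w => h (w 0) (l1 fun i : Fin (n + 1) => w i.succ) with hF
  have hFint : Integrable F :=
    (integrable_indicator_iff (measurableSet_nball 0 1)).2 (integrableOn_nball hcont 0 1)
  let e := MeasurableEquiv.piFinSuccAbove (fun _ : Fin (n + 2) => ℝ) 0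
  have he := volume_preserving_piFinSuccAbove (fun _ : Fin (n + 2) => ℝ) 0
  have hF_prod : Integrable (fun p => F (e.symm p)) (volume.prod volume) :=
    (he.symm.integrable_comp_emb e.symm.measurableEmbedding).2 hFint
  have hFe : ∀ u x, F (e.symm (u, x)) = if |u| + l1 x ≤ 1 then h u (l1 x) else 0 := by
    intro u x
    have : e.symm (u, x) = Fin.cons u x := by
      simp [e, MeasurableEquiv.piFinSuccAbove, Fin.insertNthEquiv]
    have hmem : (Fin.cons u x : Fin (n + 2) → ℝ) ∈ nball l1 0 1 ↔ |u| + l1 x ≤ 1 := by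
      simp [nball, l1, Fin.sum_univ_succ]
    rw [this, hF]
    by_cases hx : |u| + l1 x ≤ 1
    · rw [indicator_of_mem (hmem.2 hx), if_pos hx]
      simp
    · rw [indicator_of_notMem (mt hmem.1 hx), if_neg hx]
  rw [← integral_indicator (measurableSet_nball 0 1), ← hF,
    ← he.symm.integral_comp' (g := F)]
  change ∫ p, F (e.symm p) ∂(volume.prod volume) = _
  rw [integral_prod _ hF_prod]
  simp only [hFe]
  have hin : ∀ u : ℝ, ∫ x : Fin (n + 1) → ℝ, (if |u| + l1 x ≤ 1 then h u (l1 x) else 0) =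
      2 ^ (n + 1) / n.factorial * ∫ ρ in Icc (0 : ℝ) (1 - |u|), h u ρ * ρ ^ n := by
    intro u
    rw [integral_comp_l1 n fun y => if |u| + y ≤ 1 then h u y else 0]
    congr 1
    rw [integral_Icc_eq_integral_Ioc, ← Ioi_inter_Iic, ← setIntegral_indicator measurableSet_Iic]
    congr 1
    funext y
    by_cases hy : |u| + y ≤ 1
    · rw [if_pos hy, indicator_of_mem (show y ∈ Iic (1 - |u|) by rw [mem_Iic]; linarith), mul_comm]
    · rw [if_neg hy, indicator_of_notMem (show y ∉ Iic (1 - |u|) by rw [mem_Iic]; linarith),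
        mul_zero]
  simp only [hin]
  rw [integral_const_mul]
  congr 1
  refine (setIntegral_eq_integral_of_forall_compl_eq_zero fun u hu => ?_).symm
  have : 1 < |u| := by
    rw [mem_Icc, ← abs_le] at hu
    exact not_le.1 hu
  rw [Icc_eq_empty (by linarith)]
  simp

end Formula

section Average

variable {d : ℕ}

open scoped Pointwise in
lemma setIntegral_nball_eq (f : (Fin d → ℝ) → ℝ) (c : Fin d → ℝ) {r : ℝ} (hr : 0 < r) :
    ∫ y in nball l1 c r, f y = r ^ d * ∫ w in nball l1 0 1, f (c + r • w) := by
  have h1 := Measure.setIntegral_comp_smul_of_pos (volume : Measure (Fin d → ℝ)) (fun y => f (c + y))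
    (nball l1 0 1) hr
  have h2 : r • nball l1 (0 : Fin d → ℝ) 1 = (fun y => c + y) ⁻¹' nball l1 c r := by
    ext y
    rw [mem_smul_set_iff_inv_smul_mem₀ hr.ne']
    simp only [nball, mem_ofPred_eq, mem_preimage, sub_zero, add_sub_cancel_left, l1_smul,
      abs_of_pos (inv_pos.2 hr)]
    rw [inv_mul_le_iff₀ hr, mul_one]
  rw [h1, h2, (measurePreserving_add_left volume c).setIntegral_preimage_emb
    (measurableEmbedding_addLeft c)]
  simp only [Module.finrank_fin_fun, smul_eq_mul]
  rw [mul_inv_cancel_left₀ (by positivity)]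

lemma volume_nball_eq (c : Fin d → ℝ) {r : ℝ} (hr : 0 < r) :
    volume.real (nball l1 c r) = r ^ d * volume.real (nball l1 (0 : Fin d → ℝ) 1) := by
  simpa using setIntegral_nball_eq (fun _ => (1 : ℝ)) c hr

lemma setAverage_nball_eq (f : (Fin d → ℝ) → ℝ) (c : Fin d → ℝ) {r : ℝ} (hr : 0 < r) :
    ⨍ y in nball l1 c r, f y = ⨍ w in nball l1 0 1, f (c + r • w) := by
  rw [setAverage_eq, setAverage_eq, setIntegral_nball_eq f c hr, volume_nball_eq c hr, smul_eq_mul,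
    smul_eq_mul]
  field_simp

lemma volume_nball_unit_pos : 0 < volume.real (nball l1 (0 : Fin d → ℝ) 1) := by
  rw [Measure.real, ENNReal.toReal_pos_iff]
  refine ⟨?_, (isCompact_nball 0 1).measure_lt_top⟩
  refine lt_of_lt_of_le ?_ (measure_mono (s := {x : Fin d → ℝ | l1 x < 1})
    fun x hx => by simpa [nball] using le_of_lt hx)
  refine IsOpen.measure_pos _ (isOpen_lt continuous_l1 continuous_const) ⟨0, ?_⟩
  simp [l1_zero]

lemma setAverage_nball_unit_mono {f g : (Fin d → ℝ) → ℝ} (hf : Continuous f) (hg : Continuous g)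
    (h : ∀ w, l1 w ≤ 1 → f w ≤ g w) :
    ⨍ w in nball l1 0 1, f w ≤ ⨍ w in nball l1 0 1, g w := by
  rw [setAverage_eq, setAverage_eq, smul_eq_mul, smul_eq_mul]
  refine mul_le_mul_of_nonneg_left ?_ (inv_nonneg.2 measureReal_nonneg)
  exact setIntegral_mono_on (integrableOn_nball hf _ _) (integrableOn_nball hg _ _)
    (measurableSet_nball _ _) fun w hw => h w (by
      rw [nball, mem_ofPred_eq, sub_zero] at hw
      exact hw)

lemma setAverage_nball_unit_const (a : ℝ) : ⨍ _w in nball l1 (0 : Fin d → ℝ) 1, a = a := by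
  rw [setAverage_eq, setIntegral_const, smul_eq_mul, smul_eq_mul,
    inv_mul_cancel_left₀ volume_nball_unit_pos.ne']

lemma setAverage_nball_unit_sub {f g : (Fin d → ℝ) → ℝ} (hf : Continuous f) (hg : Continuous g) :
    ⨍ w in nball l1 0 1, (f w - g w) =
      (⨍ w in nball l1 0 1, f w) - ⨍ w in nball l1 0 1, g w := by
  rw [setAverage_eq, setAverage_eq, setAverage_eq,
    integral_sub (integrableOn_nball hf _ _) (integrableOn_nball hg _ _), smul_sub]

variable {g : ℝ → ℝ}

lemma setAverage_nball_unit_le_of_setIntegral {c c' : Fin d → ℝ} {r : ℝ} (hr : 0 < r)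
    (h : ∫ y in nball l1 c r, g (l1 y) ≤ ∫ y in nball l1 c' r, g (l1 y)) :
    ⨍ w in nball l1 0 1, g (l1 (c + r • w)) ≤ ⨍ w in nball l1 0 1, g (l1 (c' + r • w)) := by
  rw [setIntegral_nball_eq _ _ hr, setIntegral_nball_eq _ _ hr] at h
  rw [setAverage_eq, setAverage_eq, smul_eq_mul, smul_eq_mul]
  have := le_of_mul_le_mul_left h (by positivity)
  gcongr

/-- The average of `g ∘ ‖·‖₁` over the ball of radius `R t` centered at `(1 - R) t e_i`. -/
noncomputable def vertexAvg (g : ℝ → ℝ) (i : Fin d) (t R : ℝ) : ℝ :=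
  ⨍ w in nball l1 0 1, g (l1 ((Pi.single i ((1 - R) * t) : Fin d → ℝ) + (R * t) • w))

/-- Any ball containing `t e_i` has a larger average of `g ∘ ‖·‖₁` than one of the balls of
radius `R t` centered at `(1 - R) t e_i`, with `1 / 2 ≤ R ≤ 1`. -/
lemma exists_vertexAvg_le (hg : Continuous g) (hmono : MonotoneOn g (Ici 0)) (i : Fin d)
    {t r : ℝ} (ht : 0 < t) (hr : 0 < r) {c : Fin d → ℝ}
    (hc : (Pi.single i t : Fin d → ℝ) ∈ nball l1 c r) :
    ∃ R, 1 / 2 ≤ R ∧ R ≤ 1 ∧ vertexAvg g i t R ≤ ⨍ y in nball l1 c r, g (l1 y) := by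
  rw [setAverage_nball_eq (fun y => g (l1 y)) c hr]
  have hci : |t - c i| ≤ r := by
    have h := (abs_apply_le_l1 (Pi.single i t - c) i).trans hc
    rwa [Pi.sub_apply, Pi.single_eq_same] at h
  have hcont : ∀ (a : Fin d → ℝ) (s : ℝ), Continuous fun w : Fin d → ℝ => g (l1 (a + s • w)) :=
    fun a s => hg.comp (by fun_prop)
  rcases le_total t r with htr | htr
  · refine ⟨1, by norm_num, le_rfl, ?_⟩
    have h1 := setAverage_nball_unit_le_of_setIntegral hr
      (setIntegral_nball_mono hg hmono (c := c) (c' := 0) (fun i => by simp) r)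
    refine le_trans ?_ h1
    refine setAverage_nball_unit_mono (hcont _ _) (hcont _ _) fun w hw => ?_
    refine hmono (l1_nonneg _) (l1_nonneg _) ?_
    have : (Pi.single i ((1 - 1) * t) : Fin d → ℝ) = 0 := by simp
    rw [this, zero_add, zero_add, l1_smul, l1_smul, one_mul, abs_of_pos ht, abs_of_pos hr]
    have := l1_nonneg w
    gcongr
  · have h1 := setAverage_nball_unit_le_of_setIntegral hr
      (setIntegral_nball_mono hg hmono (c := c) (c' := Pi.single i (t - r)) (fun j => by
        by_cases h : j = i
        · subst h
          rw [Pi.single_eq_same, abs_of_nonneg (by linarith)]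
          linarith [abs_le.1 hci, le_abs_self (c j)]
        · simp [h]) r)
    rcases le_total (t / 2) r with h2 | h2
    · refine ⟨r / t, ?_, ?_, ?_⟩
      · rw [le_div_iff₀ ht]
        linarith
      · rw [div_le_one ht]
        exact htr
      · refine le_trans (le_of_eq ?_) h1
        rw [vertexAvg, sub_mul, div_mul_cancel₀ _ ht.ne', one_mul]
    · refine ⟨1 / 2, le_rfl, by norm_num, le_trans ?_ h1⟩
      refine setAverage_nball_unit_mono (hcont _ _) (hcont _ _) fun w hw => ?_
      refine hmono (l1_nonneg _) (l1_nonneg _) ?_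
      have key : ∀ a s : ℝ, 0 ≤ s → s ≤ a →
          l1 ((Pi.single i a : Fin d → ℝ) + s • w) =
            a + s * (w i + ∑ j ∈ Finset.univ.erase i, |w j|) := by
        intro a s hs hsa
        have hwi := abs_le.1 ((abs_apply_le_l1 w i).trans hw)
        rw [l1_eq_add_sum_erase i, mul_add, Finset.mul_sum, ← add_assoc]
        congr 1
        · simp only [Pi.add_apply, Pi.single_eq_same, Pi.smul_apply, smul_eq_mul]
          rw [abs_of_nonneg]
          nlinarith
        · refine Finset.sum_congr rfl fun j hj => ?_
          simp [Finset.ne_of_mem_erase hj, abs_mul, abs_of_nonneg hs]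
      rw [key _ _ (by linarith) (by linarith), key _ _ hr.le (by linarith)]
      rw [l1_eq_add_sum_erase i] at hw
      have hw' : w i + ∑ j ∈ Finset.univ.erase i, |w j| ≤ 1 := by
        linarith [le_abs_self (w i)]
      nlinarith

lemma setAverage_le_vertexAvg (hg : Continuous g) (hmono : MonotoneOn g (Ici 0)) (i : Fin d)
    {t R : ℝ} (ht : 0 < t) (hR : 0 < R) {v : Fin d → ℝ} (hv : l1 v = (1 - R) * t) :
    ⨍ w in nball l1 0 1, g (l1 (v + (R * t) • w)) ≤ vertexAvg g i t R := by
  rw [vertexAvg, ← hv]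
  exact setAverage_nball_unit_le_of_setIntegral (by positivity)
    (setIntegral_nball_le_single hg hmono v i _)

lemma setAverage_nball_unit_eq (n : ℕ) {h : ℝ → ℝ → ℝ} (hh : Continuous (Function.uncurry h)) :
    ⨍ w in nball l1 (0 : Fin (n + 2) → ℝ) 1, h (w 0) (l1 fun i : Fin (n + 1) => w i.succ) =
      ((n : ℝ) + 2) * (n + 1) / 2 *
        ∫ u in Icc (-1 : ℝ) 1, ∫ ρ in Icc (0 : ℝ) (1 - |u|), h u ρ * ρ ^ n := by
  rw [setAverage_eq, volume_nball_unit, smul_eq_mul, setIntegral_nball_unit n hh,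
    Nat.factorial_succ, Nat.factorial_succ, ← mul_assoc]
  congr 1
  push_cast
  have := Nat.factorial_pos n
  field_simp
  ring

lemma l1_single_zero_add_smul (n : ℕ) {t R : ℝ} (ht : 0 ≤ t) (hR : 0 ≤ R)
    (w : Fin (n + 2) → ℝ) :
    l1 ((Pi.single 0 ((1 - R) * t) : Fin (n + 2) → ℝ) + (R * t) • w) =
      t * (|1 - R + R * w 0| + R * l1 fun i : Fin (n + 1) => w i.succ) := by
  simp only [l1, Fin.sum_univ_succ (n := n + 1), Pi.add_apply, Pi.single_eq_same, Pi.smul_apply,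
    smul_eq_mul, mul_add t, Finset.mul_sum]
  congr 1
  · rw [← abs_of_nonneg ht, ← abs_mul, abs_of_nonneg ht]
    congr 1
    ring
  · refine Finset.sum_congr rfl fun j _ => ?_
    rw [Pi.single_eq_of_ne (Fin.succ_ne_zero j), zero_add, abs_mul, abs_mul, abs_of_nonneg ht,
      abs_of_nonneg hR]
    ring

lemma vertexAvg_eq (hg : Continuous g) (n : ℕ) {t R : ℝ} (ht : 0 ≤ t) (hR : 0 ≤ R) :
    vertexAvg g (0 : Fin (n + 2)) t R = ((n : ℝ) + 2) * (n + 1) / 2 *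
      ∫ u in Icc (-1 : ℝ) 1, ∫ ρ in Icc (0 : ℝ) (1 - |u|),
        g (t * (|1 - R + R * u| + R * ρ)) * ρ ^ n := by
  rw [← setAverage_nball_unit_eq n (h := fun u ρ => g (t * (|1 - R + R * u| + R * ρ)))
    (hg.comp (by fun_prop)), vertexAvg]
  simp only [l1_single_zero_add_smul n ht hR]

end Average

section Modulus

variable {ω : ℝ → ℝ}

namespace IsModulus

lemma pos (hω : IsModulus ω) {t : ℝ} (ht : 0 < t) : 0 < ω t := by
  by_contra h
  have h0 : ω t = 0 := le_antisymm (not_lt.1 h) (hω.nonneg t ht.le)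
  have hn : ∀ n : ℕ, ω (n * t) = 0 := by
    intro n
    induction n with
    | zero => simp [hω.map_zero]
    | succ n ih =>
      refine le_antisymm ?_ (hω.nonneg _ (by positivity))
      have := hω.subadd (n * t) t (by positivity) ht.le
      push_cast
      rw [add_mul, one_mul]
      linarith
  obtain ⟨s, hs, hs'⟩ := hω.nontrivial
  obtain ⟨n, hn'⟩ := exists_nat_ge (s / t)
  rw [div_le_iff₀ ht] at hn'
  refine hs' (le_antisymm ?_ (hω.nonneg s hs.le))
  rw [← hn n]
  exact hω.mono hs.le (hs.le.trans hn') hn'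

lemma continuous_comp_abs (hω : IsModulus ω) : Continuous fun x => ω |x| :=
  hω.cont.comp_continuous continuous_abs fun x => abs_nonneg x

lemma monotoneOn_comp_abs (hω : IsModulus ω) : MonotoneOn (fun x => ω |x|) (Ici 0) := by
  intro a ha b hb hab
  simp only [abs_of_nonneg (show (0 : ℝ) ≤ a from ha), abs_of_nonneg (show (0 : ℝ) ≤ b from hb)]
  exact hω.mono ha hb hab

lemma abs_sub_le (hω : IsModulus ω) {a b : ℝ} (ha : 0 ≤ a) (hb : 0 ≤ b) :
    |ω a - ω b| ≤ ω |a - b| := by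
  have key : ∀ a b : ℝ, 0 ≤ a → 0 ≤ b → ω a - ω b ≤ ω |a - b| := by
    intro a b ha hb
    have h1 := hω.subadd b |a - b| hb (abs_nonneg _)
    have h2 : a ≤ b + |a - b| := by linarith [le_abs_self (a - b)]
    have h3 := hω.mono ha (ha.trans h2) h2
    linarith
  rw [_root_.abs_le]
  have h1 := key a b ha hb
  have h2 := key b a hb ha
  rw [abs_sub_comm] at h2
  constructor <;> linarith

lemma nat_mul_le (hω : IsModulus ω) (n : ℕ) {t : ℝ} (ht : 0 ≤ t) : ω (n * t) ≤ n * ω t := by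
  induction n with
  | zero => simp [hω.map_zero]
  | succ n ih =>
    have := hω.subadd (n * t) t (by positivity) ht
    push_cast
    rw [add_mul, one_mul, add_mul, one_mul]
    linarith

lemma le_linear (hω : IsModulus ω) {δ q : ℝ} (hδ : 0 < δ) (hq : 0 ≤ q) :
    ω q ≤ ω δ * (1 + q / δ) := by
  have h1 : q ≤ (⌈q / δ⌉₊ : ℝ) * δ := by
    rw [← div_le_iff₀ hδ]
    exact Nat.le_ceil _
  have h2 : (⌈q / δ⌉₊ : ℝ) ≤ 1 + q / δ := by
    linarith [Nat.ceil_lt_add_one (div_nonneg hq hδ.le)]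
  calc ω q ≤ ω (⌈q / δ⌉₊ * δ) := hω.mono hq (hq.trans h1) h1
    _ ≤ ⌈q / δ⌉₊ * ω δ := hω.nat_mul_le _ hδ.le
    _ ≤ (1 + q / δ) * ω δ := mul_le_mul_of_nonneg_right h2 (hω.nonneg δ hδ.le)
    _ = _ := mul_comm _ _

lemma tendsto_zero (hω : IsModulus ω) {ε : ℝ} (hε : 0 < ε) : ∃ r, 0 < r ∧ ω r < ε := by
  have h := hω.continuous_comp_abs.continuousAt (x := 0)
  rw [Metric.continuousAt_iff] at h
  obtain ⟨δ, hδ, h⟩ := h ε hε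
  refine ⟨δ / 2, by positivity, ?_⟩
  have h2 := @h (δ / 2) (by rw [Real.dist_eq, sub_zero, abs_of_pos] <;> linarith)
  simp only [abs_zero, hω.map_zero, Real.dist_eq, sub_zero] at h2
  rw [abs_of_pos (show 0 < δ / 2 by positivity)] at h2
  exact (le_abs_self _).trans_lt h2

end IsModulus

variable {d : ℕ}

/-- The functions `f` with `|f x - f y| ≤ ω(‖x - y‖₁)`. -/
def HasModulus (ω : ℝ → ℝ) (f : (Fin d → ℝ) → ℝ) : Prop :=
  ∀ x y, |f x - f y| ≤ ω (l1 (x - y))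

lemma HasModulus.continuous (hω : IsModulus ω) {f : (Fin d → ℝ) → ℝ} (hf : HasModulus ω f) :
    Continuous f := by
  rw [continuous_iff_continuousAt]
  intro x
  rw [ContinuousAt, tendsto_iff_dist_tendsto_zero]
  have h1 : Continuous fun y : Fin d → ℝ => ω |l1 (y - x)| :=
    hω.continuous_comp_abs.comp (continuous_l1.comp (by fun_prop))
  have h2 := h1.tendsto x
  simp only [sub_self, l1_zero, abs_zero, hω.map_zero] at h2
  refine squeeze_zero (fun _ => dist_nonneg) (fun y => ?_) h2
  rw [Real.dist_eq, abs_of_nonneg (l1_nonneg _)]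
  exact hf y x

lemma HasModulus.modCont_le (hω : IsModulus ω) {f : (Fin d → ℝ) → ℝ} (hf : HasModulus ω f)
    {t : ℝ} (ht : 0 < t) : modCont l1 f t ≤ ω t := by
  refine csSup_le ⟨_, 0, 0, by simp [l1_zero, ht.le], rfl⟩ ?_
  rintro _ ⟨x, y, hxy, rfl⟩
  exact (hf x y).trans (hω.mono (l1_nonneg _) ht.le hxy)

lemma abs_sub_le_nat_mul {f : (Fin d → ℝ) → ℝ} {δ K : ℝ}
    (hK : ∀ x y, l1 (x - y) ≤ δ → |f x - f y| ≤ K) (n : ℕ) :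
    ∀ x y, l1 (x - y) ≤ n * δ → |f x - f y| ≤ n * K := by
  induction n with
  | zero =>
    intro x y h
    have : x - y = 0 := (l1_eq_zero_iff _).1 (le_antisymm (by simpa using h) (l1_nonneg _))
    rw [sub_eq_zero.1 this]
    simp
  | succ n ih =>
    intro x y h
    push_cast at h
    have hn : (0 : ℝ) < (n : ℝ) + 1 := by positivity
    set z := y + ((n : ℝ) / (n + 1)) • (x - y) with hz
    have h1 : z - y = ((n : ℝ) / (n + 1)) • (x - y) := by rw [hz]; abel
    have h2 : x - z = (1 / ((n : ℝ) + 1)) • (x - y) := by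
      have : (1 / ((n : ℝ) + 1)) = 1 - (n : ℝ) / (n + 1) := by field_simp; ring
      rw [this, sub_smul, one_smul, hz]; abel
    have h3 := hK x z (by
      rw [h2, l1_smul, abs_of_pos (by positivity), one_div, inv_mul_le_iff₀ hn]
      exact h)
    have h4 := ih z y (by
      rw [h1, l1_smul, abs_of_nonneg (by positivity), div_mul_eq_mul_div, div_le_iff₀ hn]
      nlinarith [Nat.cast_nonneg (α := ℝ) n])
    push_cast
    have := abs_sub_le (f x) (f z) (f y)
    linarith

lemma hasModulus_of_lipNorm_eq_one (hω : IsModulus ω) {f : (Fin d → ℝ) → ℝ}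
    (hf : lipNorm l1 ω f = 1) : HasModulus ω f := by
  have hb1 : BddAbove {a : ℝ | ∃ t : ℝ, 0 < t ∧ a = modCont l1 f t / ω t} := by
    by_contra h
    rw [lipNorm, Real.sSup_of_not_bddAbove h] at hf
    exact zero_ne_one hf
  have hb2 : ∀ t, 0 < t →
      BddAbove {a : ℝ | ∃ x y : Fin d → ℝ, l1 (x - y) ≤ t ∧ a = |f x - f y|} := by
    intro t ht
    have hex : ∃ s, 0 < s ∧
        BddAbove {a : ℝ | ∃ x y : Fin d → ℝ, l1 (x - y) ≤ s ∧ a = |f x - f y|} := by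
      by_contra! h
      have : {a : ℝ | ∃ t : ℝ, 0 < t ∧ a = modCont l1 f t / ω t} = {0} := by
        ext a
        constructor
        · rintro ⟨s, hs, rfl⟩
          rw [modCont, Real.sSup_of_not_bddAbove (h s hs), zero_div]
          rfl
        · rintro rfl
          exact ⟨1, one_pos, by
            rw [modCont, Real.sSup_of_not_bddAbove (h 1 one_pos), zero_div]⟩
      rw [lipNorm, this, csSup_singleton] at hf
      exact zero_ne_one hf
    obtain ⟨s, hs, K, hK⟩ := hex
    obtain ⟨n, hn⟩ := exists_nat_ge (t / s)
    rw [div_le_iff₀ hs] at hn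
    refine ⟨n * K, ?_⟩
    rintro _ ⟨x, y, hxy, rfl⟩
    exact abs_sub_le_nat_mul (fun x y h => hK ⟨x, y, h, rfl⟩) n x y (hxy.trans hn)
  intro x y
  rcases (l1_nonneg (x - y)).eq_or_lt with h | h
  · have : x - y = 0 := (l1_eq_zero_iff _).1 h.symm
    rw [this, l1_zero, hω.map_zero, sub_eq_zero.1 this]
    simp
  · have h1 : |f x - f y| ≤ modCont l1 f (l1 (x - y)) :=
      le_csSup (hb2 _ h) ⟨x, y, le_rfl, rfl⟩
    have h2 : modCont l1 f (l1 (x - y)) / ω (l1 (x - y)) ≤ 1 := by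
      rw [← hf]
      exact le_csSup hb1 ⟨_, h, rfl⟩
    rw [div_le_one (hω.pos h)] at h2
    exact h1.trans h2

lemma lipNorm_eq_one (hω : IsModulus ω) {f : (Fin d → ℝ) → ℝ} (hf : HasModulus ω f) {t : ℝ}
    (ht : 0 < t) {x y : Fin d → ℝ} (hxy : l1 (x - y) ≤ t) (h : ω t ≤ |f x - f y|) :
    lipNorm l1 ω f = 1 := by
  have hle : ∀ s, 0 < s → modCont l1 f s / ω s ≤ 1 := fun s hs => by
    rw [div_le_one (hω.pos hs)]
    exact hf.modCont_le hω hs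
  have hbdd : BddAbove {a : ℝ | ∃ t : ℝ, 0 < t ∧ a = modCont l1 f t / ω t} := by
    refine ⟨1, ?_⟩
    rintro _ ⟨s, hs, rfl⟩
    exact hle s hs
  refine le_antisymm (csSup_le ⟨_, t, ht, rfl⟩ ?_) ?_
  · rintro _ ⟨s, hs, rfl⟩
    exact hle s hs
  · refine le_trans ?_ (le_csSup hbdd ⟨t, ht, rfl⟩)
    rw [one_le_div (hω.pos ht)]
    refine h.trans (le_csSup ⟨ω t, ?_⟩ ⟨x, y, hxy, rfl⟩)
    rintro _ ⟨x, y, hxy, rfl⟩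
    exact (hf x y).trans (hω.mono (l1_nonneg _) ht.le hxy)

lemma vertexAvg_nonneg (hω : IsModulus ω) (i : Fin d) (t R : ℝ) :
    0 ≤ vertexAvg (fun x => ω |x|) i t R := by
  rw [vertexAvg, setAverage_eq]
  exact smul_nonneg (inv_nonneg.2 measureReal_nonneg)
    (integral_nonneg fun w => hω.nonneg _ (abs_nonneg _))

lemma l1_single_add_smul_le (i : Fin d) {t R : ℝ} (ht : 0 ≤ t) (hR : 0 ≤ R) (hR' : R ≤ 1)
    {w : Fin d → ℝ} (hw : l1 w ≤ 1) :
    l1 ((Pi.single i ((1 - R) * t) : Fin d → ℝ) + (R * t) • w) ≤ t := by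
  refine (l1_add_le _ _).trans ?_
  rw [l1_single, l1_smul, abs_of_nonneg (mul_nonneg (by linarith) ht), abs_of_nonneg (by positivity)]
  nlinarith [mul_nonneg hR ht]

lemma continuous_comp_l1_add_smul {g : ℝ → ℝ} (hg : Continuous g) (a : Fin d → ℝ) (s : ℝ) :
    Continuous fun w : Fin d → ℝ => g (l1 (a + s • w)) :=
  hg.comp (by fun_prop)

lemma vertexAvg_one_le (hω : IsModulus ω) (i : Fin d) {t : ℝ} (ht : 0 ≤ t) :
    vertexAvg (fun x => ω |x|) i t 1 ≤ ω t := by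
  rw [← setAverage_nball_unit_const (d := d) (ω t)]
  refine setAverage_nball_unit_mono (continuous_comp_l1_add_smul hω.continuous_comp_abs _ _)
    continuous_const fun w hw => ?_
  beta_reduce
  rw [abs_of_nonneg (l1_nonneg _)]
  exact hω.mono (l1_nonneg _) ht (l1_single_add_smul_le i ht zero_le_one le_rfl hw)

/-- The set of averages of `|f|` over balls containing `x`. -/
def avgSet (f : (Fin d → ℝ) → ℝ) (x : Fin d → ℝ) : Set ℝ :=
  {a : ℝ | ∃ c : Fin d → ℝ, ∃ R : ℝ, 0 < R ∧ x ∈ nball l1 c R ∧ a = ⨍ y in nball l1 c R, |f y|}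

lemma avgSet_nonempty (f : (Fin d → ℝ) → ℝ) (x : Fin d → ℝ) : (avgSet f x).Nonempty :=
  ⟨_, x, 1, one_pos, by simp [nball, l1_zero], rfl⟩

lemma exists_avgSet_sub_le (hω : IsModulus ω) {f : (Fin d → ℝ) → ℝ} (hf : HasModulus ω f)
    (i : Fin d) {t R : ℝ} (ht : 0 < t) (hR : 1 / 2 ≤ R) (hR' : R ≤ 1) {x y : Fin d → ℝ}
    (hxy : l1 (x - y) ≤ t) {a : ℝ} (ha : a ∈ avgSet f x) :
    ∃ b ∈ avgSet f y, a ≤ b + vertexAvg (fun x => ω |x|) i t R := by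
  obtain ⟨c, r, hr, hx, rfl⟩ := ha
  by_cases hy : y ∈ nball l1 c r
  · exact ⟨_, ⟨c, r, hr, hy, rfl⟩, by linarith [vertexAvg_nonneg hω i t R]⟩
  have hL : r < l1 (y - c) := not_le.1 hy
  have hL' : l1 (y - c) ≤ r + t := by
    have h1 := l1_add_le (y - x) (x - c)
    rw [sub_add_sub_cancel, l1_sub_comm y x] at h1
    have h2 : l1 (x - c) ≤ r := hx
    linarith
  set L := l1 (y - c)
  have hLpos : 0 < L := hr.trans hL
  have hRt : 0 ≤ (1 - R) * t := mul_nonneg (by linarith) ht.le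
  have hRt' : (1 - R) * t ≤ R * t := mul_le_mul_of_nonneg_right (by linarith) ht.le
  have hRt'' : 0 < R * t := by nlinarith
  set v := ((1 - R) * t / L) • (y - c) with hv
  have hlv : l1 v = (1 - R) * t := by
    rw [hv, l1_smul, abs_of_nonneg (by positivity)]
    exact div_mul_cancel₀ _ hLpos.ne'
  have hr' : 0 < r + R * t := by positivity
  have hy' : y ∈ nball l1 (c + v) (r + R * t) := by
    change l1 (y - (c + v)) ≤ _
    have : y - (c + v) = (1 - (1 - R) * t / L) • (y - c) := by
      rw [sub_smul, one_smul, ← hv]; abel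
    rw [this, l1_smul]
    change _ * L ≤ _
    rw [← abs_of_pos hLpos, ← abs_mul, abs_of_pos hLpos, sub_mul, one_mul,
      div_mul_cancel₀ _ hLpos.ne', abs_le]
    constructor <;> linarith
  refine ⟨_, ⟨c + v, r + R * t, hr', hy', rfl⟩, ?_⟩
  have hfc : Continuous fun y => |f y| := (hf.continuous hω).abs
  have hca : ∀ (a : Fin d → ℝ) (s : ℝ), Continuous fun w : Fin d → ℝ => |f (a + s • w)| :=
    fun a s => hfc.comp (by fun_prop)
  rw [setAverage_nball_eq _ c hr, setAverage_nball_eq _ (c + v) hr']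
  have h1 := setAverage_le_vertexAvg hω.continuous_comp_abs hω.monotoneOn_comp_abs i ht
    (by linarith : 0 < R) hlv
  rw [← sub_le_iff_le_add', ← setAverage_nball_unit_sub (hca _ _) (hca _ _)]
  refine le_trans (setAverage_nball_unit_mono ((hca _ _).sub (hca _ _))
    (continuous_comp_l1_add_smul hω.continuous_comp_abs _ _) fun w _ => ?_) h1
  refine (abs_sub_abs_le_abs_sub _ _).trans ((hf _ _).trans (le_of_eq ?_))
  rw [abs_of_nonneg (l1_nonneg _), ← l1_neg]
  congr 2
  rw [add_smul]
  abel

lemma abs_maxFn_sub_le (hω : IsModulus ω) {f : (Fin d → ℝ) → ℝ} (hf : HasModulus ω f)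
    (i : Fin d) {t R : ℝ} (ht : 0 < t) (hR : 1 / 2 ≤ R) (hR' : R ≤ 1) {x y : Fin d → ℝ}
    (hxy : l1 (x - y) ≤ t) :
    |maxFn l1 f x - maxFn l1 f y| ≤ vertexAvg (fun x => ω |x|) i t R := by
  have hbdd : ∀ x y : Fin d → ℝ, BddAbove (avgSet f y) → BddAbove (avgSet f x) := by
    rintro x y ⟨K, hK⟩
    refine ⟨K + vertexAvg (fun x => ω |x|) i (l1 (x - y) + 1) 1, fun a ha => ?_⟩
    obtain ⟨b, hb, hab⟩ := exists_avgSet_sub_le hω hf i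
      (add_pos_of_nonneg_of_pos (l1_nonneg (x - y)) one_pos) (by norm_num) le_rfl
      (le_add_of_nonneg_right zero_le_one) ha
    linarith [hK hb]
  by_cases hx : BddAbove (avgSet f x)
  · have key : ∀ x y : Fin d → ℝ, BddAbove (avgSet f y) → l1 (x - y) ≤ t →
        maxFn l1 f x ≤ maxFn l1 f y + vertexAvg (fun x => ω |x|) i t R := by
      intro x y hy hxy
      refine csSup_le (avgSet_nonempty f x) fun a ha => ?_
      obtain ⟨b, hb, hab⟩ := exists_avgSet_sub_le hω hf i ht hR hR' hxy ha
      have : b ≤ maxFn l1 f y := le_csSup hy hb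
      linarith
    have h1 := key x y (hbdd y x hx) hxy
    have h2 := key y x hx (by rwa [l1_sub_comm])
    rw [abs_le]
    constructor <;> linarith
  · have hy : ¬ BddAbove (avgSet f y) := mt (hbdd x y) hx
    have h1 : maxFn l1 f x = 0 := Real.sSup_of_not_bddAbove hx
    have h2 : maxFn l1 f y = 0 := Real.sSup_of_not_bddAbove hy
    rw [h1, h2, sub_zero, abs_zero]
    exact vertexAvg_nonneg hω i t R

/-- The infimum over `1 / 2 ≤ R ≤ 1` of the normalized averages over balls of radius `R t`
centered at `(1 - R) t e_i`. -/
noncomputable def infVertexAvg (ω : ℝ → ℝ) (i : Fin d) (t : ℝ) : ℝ :=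
  sInf {b : ℝ | ∃ R : ℝ, 1 / 2 ≤ R ∧ R ≤ 1 ∧ b = vertexAvg (fun x => ω |x|) i t R / ω t}

lemma infVertexAvg_le (hω : IsModulus ω) (i : Fin d) {t R : ℝ} (ht : 0 ≤ t) (hR : 1 / 2 ≤ R)
    (hR' : R ≤ 1) : infVertexAvg ω i t ≤ vertexAvg (fun x => ω |x|) i t R / ω t := by
  refine csInf_le ⟨0, ?_⟩ ⟨R, hR, hR', rfl⟩
  rintro _ ⟨R, _, _, rfl⟩
  exact div_nonneg (vertexAvg_nonneg hω i t R) (hω.nonneg t ht)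

lemma le_infVertexAvg {i : Fin d} {t a : ℝ}
    (h : ∀ R, 1 / 2 ≤ R → R ≤ 1 → a ≤ vertexAvg (fun x => ω |x|) i t R / ω t) :
    a ≤ infVertexAvg ω i t := by
  refine le_csInf ⟨_, 1, by norm_num, le_rfl, rfl⟩ ?_
  rintro _ ⟨R, hR, hR', rfl⟩
  exact h R hR hR'

lemma infVertexAvg_le_one (hω : IsModulus ω) (i : Fin d) {t : ℝ} (ht : 0 < t) :
    infVertexAvg ω i t ≤ 1 := by
  refine (infVertexAvg_le hω i ht.le (by norm_num) le_rfl).trans ?_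
  rw [div_le_one (hω.pos ht)]
  exact vertexAvg_one_le hω i ht.le

lemma modCont_maxFn_div_le (hω : IsModulus ω) {f : (Fin d → ℝ) → ℝ} (hf : HasModulus ω f)
    (i : Fin d) {t : ℝ} (ht : 0 < t) :
    modCont l1 (maxFn l1 f) t / ω t ≤ infVertexAvg ω i t := by
  refine le_infVertexAvg fun R hR hR' => ?_
  refine div_le_div_of_nonneg_right ?_ (hω.nonneg t ht.le)
  refine csSup_le ⟨_, 0, 0, by simp [l1_zero, ht.le], rfl⟩ ?_
  rintro _ ⟨x, y, hxy, rfl⟩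
  exact abs_maxFn_sub_le hω hf i ht hR hR' hxy

/-- The extremal function `max (0, ω(t) - ω(‖y‖₁))`. -/
noncomputable def bump (ω : ℝ → ℝ) (t : ℝ) (y : Fin d → ℝ) : ℝ := ω t - min (ω t) (ω |l1 y|)

lemma bump_nonneg (t : ℝ) (y : Fin d → ℝ) : 0 ≤ bump ω t y := sub_nonneg.2 (min_le_left _ _)

lemma bump_le (hω : IsModulus ω) {t : ℝ} (ht : 0 ≤ t) (y : Fin d → ℝ) : bump ω t y ≤ ω t :=
  sub_le_self _ (le_min (hω.nonneg t ht) (hω.nonneg _ (abs_nonneg _)))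

lemma hasModulus_bump (hω : IsModulus ω) (t : ℝ) : HasModulus ω (bump ω t : (Fin d → ℝ) → ℝ) := by
  intro x y
  rw [bump, bump, sub_sub_sub_cancel_left]
  refine (abs_min_sub_min_le_max _ _ _ _).trans ?_
  rw [sub_self, abs_zero, abs_of_nonneg (l1_nonneg x), abs_of_nonneg (l1_nonneg y),
    max_eq_right (abs_nonneg _), l1_sub_comm]
  refine (hω.abs_sub_le (l1_nonneg y) (l1_nonneg x)).trans ?_
  exact hω.mono (mem_Ici.2 (abs_nonneg _)) (l1_nonneg _) (abs_l1_sub_l1_le y x)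

lemma lipNorm_bump (hω : IsModulus ω) (i : Fin d) {t : ℝ} (ht : 0 < t) :
    lipNorm l1 ω (bump ω t : (Fin d → ℝ) → ℝ) = 1 := by
  refine lipNorm_eq_one hω (hasModulus_bump hω t) ht (x := 0) (y := Pi.single i t) ?_ ?_
  · rw [zero_sub, l1_neg, l1_single, abs_of_pos ht]
  · simp [bump, l1_zero, l1_single, abs_of_pos ht, hω.map_zero, hω.nonneg t ht.le, le_abs_self]

lemma setAverage_bump (hω : IsModulus ω) (t : ℝ) (c : Fin d → ℝ) {r : ℝ} (hr : 0 < r) :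
    ⨍ y in nball l1 c r, |bump ω t y| =
      ω t - ⨍ y in nball l1 c r, (fun x => min (ω t) (ω |x|)) (l1 y) := by
  rw [setAverage_nball_eq _ c hr, setAverage_nball_eq _ c hr]
  simp only [abs_of_nonneg (bump_nonneg _ _)]
  simp only [bump]
  rw [setAverage_nball_unit_sub continuous_const (continuous_comp_l1_add_smul
    (g := fun x => min (ω t) (ω |x|)) (continuous_const.min hω.continuous_comp_abs) c r),
    setAverage_nball_unit_const]

lemma maxFn_bump_single_le (hω : IsModulus ω) (i : Fin d) {t : ℝ} (ht : 0 < t) :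
    maxFn l1 (bump ω t) (Pi.single i t) ≤ ω t - ω t * infVertexAvg ω i t := by
  refine csSup_le (avgSet_nonempty _ _) ?_
  rintro _ ⟨c, r, hr, hc, rfl⟩
  rw [setAverage_bump hω t c hr]
  have hgc : Continuous fun x => min (ω t) (ω |x|) := continuous_const.min hω.continuous_comp_abs
  obtain ⟨R, hR, hR', h⟩ := exists_vertexAvg_le hgc
    (fun a ha b hb hab => min_le_min_left _ (hω.monotoneOn_comp_abs ha hb hab)) i ht hr hc
  have h1 := infVertexAvg_le hω i ht.le hR hR'
  rw [le_div_iff₀ (hω.pos ht)] at h1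
  have h2 : vertexAvg (fun x => ω |x|) i t R ≤ vertexAvg (fun x => min (ω t) (ω |x|)) i t R := by
    refine setAverage_nball_unit_mono (continuous_comp_l1_add_smul hω.continuous_comp_abs _ _)
      (continuous_comp_l1_add_smul hgc _ _) fun w hw => le_min ?_ le_rfl
    beta_reduce
    rw [abs_of_nonneg (l1_nonneg _)]
    exact hω.mono (l1_nonneg _) ht.le (l1_single_add_smul_le i ht.le (by linarith) hR' hw)
  linarith

lemma le_maxFn_bump_zero (hω : IsModulus ω) {t : ℝ} (ht : 0 < t) :
    ω t ≤ maxFn l1 (bump ω t) (0 : Fin d → ℝ) := by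
  have hbc : Continuous fun y : Fin d → ℝ => |bump ω t y| :=
    ((hasModulus_bump hω t).continuous hω).abs
  have hca : ∀ (a : Fin d → ℝ) (s : ℝ), Continuous fun w : Fin d → ℝ => |bump ω t (a + s • w)| :=
    fun a s => hbc.comp (by fun_prop)
  refine le_of_forall_pos_sub_le fun ε hε => ?_
  obtain ⟨r, hr, hrε⟩ := hω.tendsto_zero hε
  have hbdd : BddAbove (avgSet (bump ω t) (0 : Fin d → ℝ)) := by
    refine ⟨ω t, ?_⟩
    rintro _ ⟨c, s, hs, -, rfl⟩
    rw [setAverage_nball_eq _ c hs]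
    refine (setAverage_nball_unit_mono (hca c s) continuous_const fun w _ => ?_).trans
      (setAverage_nball_unit_const (ω t)).le
    rw [abs_of_nonneg (bump_nonneg _ _)]
    exact bump_le hω ht.le _
  refine le_trans ?_ (le_csSup hbdd ⟨0, r, hr, by simp [nball, l1_zero, hr.le], rfl⟩)
  rw [setAverage_nball_eq _ 0 hr, ← setAverage_nball_unit_const (d := d) (ω t - ε)]
  refine setAverage_nball_unit_mono continuous_const (hca 0 r) fun w hw => ?_
  rw [abs_of_nonneg (bump_nonneg _ _), bump, zero_add, l1_smul, abs_of_pos hr]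
  have h1 : ω |r * l1 w| ≤ ω r := by
    have h0 := mul_nonneg hr.le (l1_nonneg w)
    rw [abs_of_nonneg h0]
    exact hω.mono h0 hr.le (by nlinarith)
  have h2 := min_le_right (ω t) (ω |r * l1 w|)
  linarith

/-- The operator norm on `Lip(ω)` as a supremum of normalized averages. -/
theorem opNorm_l1_eq (hω : IsModulus ω) (i : Fin d) :
    opNorm d l1 ω = sSup {a : ℝ | ∃ t : ℝ, 0 < t ∧ a = infVertexAvg ω i t} := by
  set S := {a : ℝ | ∃ t : ℝ, 0 < t ∧ a = infVertexAvg ω i t}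
  have hS : BddAbove S := by
    refine ⟨1, ?_⟩
    rintro _ ⟨t, ht, rfl⟩
    exact infVertexAvg_le_one hω i ht
  have hle : ∀ f : (Fin d → ℝ) → ℝ, HasModulus ω f → ∀ t, 0 < t →
      modCont l1 (maxFn l1 f) t / ω t ≤ sSup S := fun f hf t ht =>
    (modCont_maxFn_div_le hω hf i ht).trans (le_csSup hS ⟨t, ht, rfl⟩)
  have hop : ∀ f : (Fin d → ℝ) → ℝ, lipNorm l1 ω f = 1 → lipNorm l1 ω (maxFn l1 f) ≤ sSup S := by
    intro f hf
    refine csSup_le ⟨_, 1, one_pos, rfl⟩ ?_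
    rintro _ ⟨t, ht, rfl⟩
    exact hle f (hasModulus_of_lipNorm_eq_one hω hf) t ht
  refine le_antisymm (csSup_le ⟨_, bump ω 1, lipNorm_bump hω i one_pos, rfl⟩ ?_)
    (csSup_le ⟨_, 1, one_pos, rfl⟩ ?_)
  · rintro _ ⟨f, hf, rfl⟩
    exact hop f hf
  · rintro _ ⟨t, ht, rfl⟩
    have hopb : BddAbove {a : ℝ | ∃ f : (Fin d → ℝ) → ℝ, lipNorm l1 ω f = 1 ∧
        a = lipNorm l1 ω (maxFn l1 f)} := by
      refine ⟨sSup S, ?_⟩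
      rintro _ ⟨f, hf, rfl⟩
      exact hop f hf
    refine le_trans ?_ (le_csSup hopb ⟨bump ω t, lipNorm_bump hω i ht, rfl⟩)
    have hmod := hasModulus_bump (d := d) hω t
    have hlipb : BddAbove {a : ℝ | ∃ s : ℝ, 0 < s ∧
        a = modCont l1 (maxFn l1 (bump ω t : (Fin d → ℝ) → ℝ)) s / ω s} := by
      refine ⟨sSup S, ?_⟩
      rintro _ ⟨s, hs, rfl⟩
      exact hle _ hmod s hs
    refine le_trans ?_ (le_csSup hlipb ⟨t, ht, rfl⟩)
    rw [le_div_iff₀ (hω.pos ht)]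
    have hmb : BddAbove {a : ℝ | ∃ x y : Fin d → ℝ, l1 (x - y) ≤ t ∧
        a = |maxFn l1 (bump ω t) x - maxFn l1 (bump ω t) y|} := by
      refine ⟨vertexAvg (fun x => ω |x|) i t 1, ?_⟩
      rintro _ ⟨x, y, hxy, rfl⟩
      exact abs_maxFn_sub_le hω hmod i ht (by norm_num) le_rfl hxy
    refine le_trans ?_ (le_csSup hmb ⟨0, Pi.single i t, ?_, rfl⟩)
    · have h1 := maxFn_bump_single_le hω i ht
      have h2 := le_maxFn_bump_zero (d := d) hω ht
      refine le_trans ?_ (le_abs_self _)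
      linarith
    · rw [zero_sub, l1_neg, l1_single, abs_of_pos ht]

end Modulus

section Formula

lemma setIntegral_Icc_comp_abs {F : ℝ → ℝ} (hF : Continuous F) :
    ∫ u in Icc (-1 : ℝ) 1, F (1 - |u|) = 2 * ∫ s in (0 : ℝ)..1, F s := by
  have hc : Continuous fun u : ℝ => F (1 - |u|) := hF.comp (by fun_prop)
  have hright : ∫ u in (0 : ℝ)..1, F (1 - |u|) = ∫ s in (0 : ℝ)..1, F s := by
    have h := intervalIntegral.integral_comp_sub_left (a := 0) (b := 1) F 1
    rw [sub_self, sub_zero] at h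
    rw [← h]
    refine intervalIntegral.integral_congr fun u hu => ?_
    rw [uIcc_of_le zero_le_one] at hu
    simp only [abs_of_nonneg hu.1]
  have hleft : ∫ u in (-1 : ℝ)..0, F (1 - |u|) = ∫ s in (0 : ℝ)..1, F s := by
    have h := intervalIntegral.integral_comp_neg (a := 0) (b := 1) fun u => F (1 - |u|)
    simp only [abs_neg, neg_zero] at h
    rw [← h, hright]
  rw [integral_Icc_eq_integral_Ioc, ← intervalIntegral.integral_of_le (by norm_num),
    ← intervalIntegral.integral_add_adjacent_intervals (hc.intervalIntegrable _ 0)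
      (hc.intervalIntegrable 0 _), hleft, hright]
  ring

lemma setAverage_nball_unit_gap (n : ℕ) :
    ⨍ w in nball l1 (0 : Fin (n + 2) → ℝ) 1, (1 + |w 0| - l1 fun i : Fin (n + 1) => w i.succ) =
      3 / ((n : ℝ) + 3) := by
  have h1 := setAverage_nball_unit_eq n (h := fun u ρ => 1 + |u| - ρ) (by
    unfold Function.uncurry
    fun_prop)
  beta_reduce at h1
  rw [h1]
  have hn1 : (n : ℝ) + 1 ≠ 0 := by positivity
  have hn2 : (n : ℝ) + 2 ≠ 0 := by positivity
  have hn3 : (n : ℝ) + 3 ≠ 0 := by positivity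
  have hinner : ∀ u ∈ Icc (-1 : ℝ) 1, ∫ ρ in Icc (0 : ℝ) (1 - |u|), (1 + |u| - ρ) * ρ ^ n =
      (fun s : ℝ => 2 / ((n : ℝ) + 1) * s ^ (n + 1) -
        (1 / ((n : ℝ) + 1) + 1 / ((n : ℝ) + 2)) * s ^ (n + 2)) (1 - |u|) := by
    intro u hu
    have hs : 0 ≤ 1 - |u| := sub_nonneg.2 (abs_le.2 hu)
    rw [integral_Icc_eq_integral_Ioc, ← intervalIntegral.integral_of_le hs]
    have : ∀ ρ : ℝ, (1 + |u| - ρ) * ρ ^ n = (1 + |u|) * ρ ^ n - ρ ^ (n + 1) := fun ρ => by ring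
    simp only [this]
    rw [intervalIntegral.integral_sub (Continuous.intervalIntegrable (by fun_prop) _ _)
      (Continuous.intervalIntegrable (by fun_prop) _ _), intervalIntegral.integral_const_mul,
      integral_pow, integral_pow]
    push_cast
    have h2 : 1 + |u| = 2 - (1 - |u|) := by ring
    rw [h2]
    generalize 1 - |u| = s
    rw [zero_pow (by simp), zero_pow (by simp)]
    field_simp
    ring
  rw [setIntegral_congr_fun measurableSet_Icc hinner, setIntegral_Icc_comp_abs
      (F := fun s : ℝ => 2 / ((n : ℝ) + 1) * s ^ (n + 1) -
        (1 / ((n : ℝ) + 1) + 1 / ((n : ℝ) + 2)) * s ^ (n + 2)) (by fun_prop),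
    intervalIntegral.integral_sub (Continuous.intervalIntegrable (by fun_prop) _ _)
      (Continuous.intervalIntegrable (by fun_prop) _ _), intervalIntegral.integral_const_mul,
    intervalIntegral.integral_const_mul, integral_pow, integral_pow]
  rw [zero_pow (by simp), zero_pow (by simp), one_pow, one_pow]
  push_cast
  have e1 : (n : ℝ) + 1 + 1 = n + 2 := by ring
  have e2 : (n : ℝ) + 2 + 1 = n + 3 := by ring
  rw [e1, e2]
  field_simp
  ring

variable {ω : ℝ → ℝ}

lemma le_vertexAvg_one (hω : IsModulus ω) (n : ℕ) {δ R : ℝ} (hδ : 0 < δ) (hR : 0 ≤ R)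
    (hR' : R ≤ 1) :
    ω 1 - ω δ * (1 + 3 / ((n : ℝ) + 3) / δ) ≤
      vertexAvg (fun x => ω |x|) (0 : Fin (n + 2)) 1 R := by
  have hqc : Continuous fun w : Fin (n + 2) → ℝ =>
      1 + |w 0| - l1 fun i : Fin (n + 1) => w i.succ :=
    (by fun_prop : Continuous fun w : Fin (n + 2) → ℝ => 1 + |w 0|).sub
      (continuous_l1.comp (by fun_prop))
  have hω1 := hω.nonneg δ hδ.le
  have havg : ⨍ w in nball l1 (0 : Fin (n + 2) → ℝ) 1,
      (ω 1 - ω δ * (1 + (1 + |w 0| - l1 fun i : Fin (n + 1) => w i.succ) / δ)) =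
      ω 1 - ω δ * (1 + 3 / ((n : ℝ) + 3) / δ) := by
    have h := setAverage_nball_unit_gap n
    have h2 := setAverage_nball_unit_sub (d := n + 2) (f := fun _ => ω 1 - ω δ)
      (g := fun w => ω δ / δ * (1 + |w 0| - l1 fun i : Fin (n + 1) => w i.succ))
      continuous_const (continuous_const.mul hqc)
    have h3 : ⨍ w in nball l1 (0 : Fin (n + 2) → ℝ) 1,
        ω δ / δ * (1 + |w 0| - l1 fun i : Fin (n + 1) => w i.succ) =
        ω δ / δ * (3 / ((n : ℝ) + 3)) := by
      rw [← h]
      exact integral_const_mul _ _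
    rw [setAverage_nball_unit_const, h3] at h2
    rw [show ω 1 - ω δ * (1 + 3 / ((n : ℝ) + 3) / δ) =
      ω 1 - ω δ - ω δ / δ * (3 / ((n : ℝ) + 3)) by ring, ← h2]
    congr 1
    ext w
    ring
  rw [← havg]
  refine setAverage_nball_unit_mono
    (by fun_prop (disch := assumption)) (continuous_comp_l1_add_smul hω.continuous_comp_abs _ _)
    fun w hw => ?_
  beta_reduce
  rw [abs_of_nonneg (l1_nonneg _), l1_single_zero_add_smul n zero_le_one hR, one_mul]
  have hw' : l1 w = |w 0| + l1 fun i : Fin (n + 1) => w i.succ := Fin.sum_univ_succ _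
  set ρ := l1 fun i : Fin (n + 1) => w i.succ
  have hρ : 0 ≤ ρ := l1_nonneg _
  set q := 1 + |w 0| - ρ with hq
  have hq0 : 0 ≤ q := by linarith [abs_nonneg (w 0)]
  set s := |1 - R + R * w 0| + R * ρ with hs
  have hs0 : 0 ≤ s := by positivity
  have hsq : 1 ≤ s + q := by
    have h1 := le_abs_self (1 - R + R * w 0)
    have h2 : R * -|w 0| ≤ R * w 0 := mul_le_mul_of_nonneg_left (neg_abs_le _) hR
    have h3 : R * q ≤ q := mul_le_of_le_one_left hq0 hR'
    nlinarith
  have h1 := hω.mono (mem_Ici.2 zero_le_one) (mem_Ici.2 (add_nonneg hs0 hq0)) hsq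
  have h2 := hω.subadd s q hs0 hq0
  have h3 := hω.le_linear hδ hq0
  linarith

lemma op1_eq (hω : IsModulus ω) (n : ℕ) :
    op1 ω (n + 2) = sSup {a : ℝ | ∃ t : ℝ, 0 < t ∧ a = infVertexAvg ω (0 : Fin (n + 2)) t} :=
  opNorm_l1_eq hω 0

lemma op1_le_one (hω : IsModulus ω) (n : ℕ) : op1 ω (n + 2) ≤ 1 := by
  rw [op1_eq hω]
  refine csSup_le ⟨_, 1, one_pos, rfl⟩ ?_
  rintro _ ⟨t, ht, rfl⟩
  exact infVertexAvg_le_one hω 0 ht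

lemma le_op1 (hω : IsModulus ω) (n : ℕ) {δ : ℝ} (hδ : 0 < δ) :
    1 - ω δ * (1 + 3 / ((n : ℝ) + 3) / δ) / ω 1 ≤ op1 ω (n + 2) := by
  have h1 := hω.pos one_pos
  rw [op1_eq hω]
  refine le_csSup_of_le ⟨1, ?_⟩ ⟨1, one_pos, rfl⟩ (le_infVertexAvg fun R hR hR' => ?_)
  · rintro _ ⟨t, ht, rfl⟩
    exact infVertexAvg_le_one hω 0 ht
  · rw [one_sub_div h1.ne']
    exact div_le_div_of_nonneg_right (le_vertexAvg_one hω n hδ (by linarith) hR') h1.le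

lemma tendsto_op1 (hω : IsModulus ω) : Tendsto (op1 ω) atTop (𝓝 1) := by
  rw [← tendsto_add_atTop_iff_nat 2]
  refine tendsto_order.2 ⟨fun a ha => ?_, fun a ha =>
    Eventually.of_forall fun n => (op1_le_one hω n).trans_lt ha⟩
  have h1 := hω.pos one_pos
  obtain ⟨δ, hδ, hδa⟩ := hω.tendsto_zero (mul_pos h1 (sub_pos.2 ha))
  have hlim : Tendsto (fun n : ℕ => 1 - ω δ * (1 + 3 / ((n : ℝ) + 3) / δ) / ω 1) atTop
      (𝓝 (1 - ω δ * (1 + 0 / δ) / ω 1)) := by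
    have h3 : Tendsto (fun n : ℕ => 3 / ((n : ℝ) + 3)) atTop (𝓝 0) :=
      tendsto_const_nhds.div_atTop
        (tendsto_atTop_add_const_right _ _ tendsto_natCast_atTop_atTop)
    exact tendsto_const_nhds.sub
      ((((h3.div_const δ).const_add 1).const_mul (ω δ)).div_const (ω 1))
  have ha' : a < 1 - ω δ * (1 + 0 / δ) / ω 1 := by
    rw [zero_div, add_zero, mul_one, lt_sub_comm, div_lt_iff₀ h1, mul_comm]
    exact hδa
  filter_upwards [hlim.eventually_const_lt ha'] with n hn
  exact hn.trans_le (le_op1 hω n hδ)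

lemma vertexAvg_div_eq (hω : IsModulus ω) (n : ℕ) {t R : ℝ} (ht : 0 ≤ t) (hR : 0 ≤ R) :
    vertexAvg (fun x => ω |x|) (0 : Fin (n + 2)) t R / ω t =
      (((n + 2 : ℕ) : ℝ) * (((n + 2 : ℕ) : ℝ) - 1) / (2 * ω t)) *
        ∫ u in Icc (-1 : ℝ) 1, ∫ ρ in Icc (0 : ℝ) (1 - |u|),
          ω (t * (|1 - R + R * u| + R * ρ)) * ρ ^ n := by
  have h : ∀ u : ℝ, ∫ ρ in Icc (0 : ℝ) (1 - |u|),
      ω |t * (|1 - R + R * u| + R * ρ)| * ρ ^ n =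
      ∫ ρ in Icc (0 : ℝ) (1 - |u|), ω (t * (|1 - R + R * u| + R * ρ)) * ρ ^ n := fun u =>
    setIntegral_congr_fun measurableSet_Icc fun ρ hρ => by
      have hρ0 := hρ.1
      rw [abs_of_nonneg (a := t * _) (by positivity)]
  rw [vertexAvg_eq hω.continuous_comp_abs n ht hR]
  simp only [h]
  rw [mul_div_right_comm, div_div]
  push_cast
  ring_nf

end Formula

/-- Integral formula for the operator norm of the uncentered maximal operator associated to
`ℓ₁` balls (cross-polytopes) on `Lip(ω)` for `d ≥ 2`, and the limit `1` as `d → ∞`. -/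
theorem stmt17 (ω : ℝ → ℝ) (hω : IsModulus ω) :
    (∀ d : ℕ, 2 ≤ d →
      op1 ω d =
        sSup {a : ℝ | ∃ t : ℝ, 0 < t ∧
          a = sInf {b : ℝ | ∃ R : ℝ, 1 / 2 ≤ R ∧ R ≤ 1 ∧
            b = ((d : ℝ) * ((d : ℝ) - 1) / (2 * ω t)) *
                ∫ u in Set.Icc (-1 : ℝ) 1,
                  ∫ ρ in Set.Icc (0 : ℝ) (1 - |u|),
                    ω (t * (|1 - R + R * u| + R * ρ)) * ρ ^ (d - 2)}}) ∧
    Filter.Tendsto (fun d : ℕ => op1 ω d) Filter.atTop (nhds 1) := by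
  refine ⟨fun d hd => ?_, tendsto_op1 hω⟩
  obtain ⟨n, rfl⟩ := Nat.exists_eq_add_of_le' hd
  rw [op1_eq hω]
  refine congrArg sSup (Set.ext fun a => exists_congr fun t => and_congr_right fun ht => ?_)
  have h : infVertexAvg ω (0 : Fin (n + 2)) t = _ :=
    congrArg sInf (Set.ext fun b => exists_congr fun R => and_congr_right fun hR =>
      and_congr_right fun _ =>
        Eq.congr_right (vertexAvg_div_eq hω n ht.le (le_trans (by norm_num) hR)))
  rw [h]
  rfl
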